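/- Let F be a field of characteristic zero and let A, B ∈ Mₙ(F), where at least one of A and B is nilpotent. Then 𝒞𝓛(A) = 𝒞𝓛(B) if and only if A and B are odd polynomially equivalent. -/

import Mathlib

/-- The clifforder of a matrix `A`: all matrices anti-commuting with `A`. -/
def clifforder {n : ℕ} {F : Type*} [Field F] (A : Matrix (Fin n) (Fin n) F) :
    Set (Matrix (Fin n) (Fin n) F) :=
  {X | A * X = -(X * A)}

/-- `A` and `B` are odd polynomially equivalent: each is an odd polynomial in the other. -/
def OddPolyEquiv {n : ℕ} {F : Type*} [Field F] (A B : Matrix (Fin n) (Fin n) F) : Prop :=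
  ∃ f g : Polynomial F,
    (∀ i ∈ f.support, Odd i) ∧ (∀ i ∈ g.support, Odd i) ∧
    B = Polynomial.aeval A f ∧ A = Polynomial.aeval B g

open Polynomial

section AntiCommuting

variable {R S : Type*} [CommRing R] [Ring S] [Algebra R S]

theorem aeval_mul_eq_mul_aeval_neg {a x : S} (h : a * x = -(x * a)) (p : R[X]) :
    aeval a p * x = x * aeval (-a) p := by
  have hx : SemiconjBy x (-a) a := by simp [SemiconjBy, h]
  induction p using Polynomial.induction_on' with
  | add p q hp hq => simp only [map_add, add_mul, mul_add, hp, hq]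
  | monomial i c =>
    rw [aeval_monomial, aeval_monomial, mul_assoc, ← (hx.pow_right i).eq, ← mul_assoc,
      ← mul_assoc, Algebra.commutes c x]

theorem aeval_neg_of_odd_support {p : R[X]} (hp : ∀ i ∈ p.support, Odd i) (a : S) :
    aeval (-a) p = -aeval a p := by
  simp only [aeval_eq_sum_range' (Nat.lt_succ_self _), ← Finset.sum_neg_distrib]
  refine Finset.sum_congr rfl fun i _ => ?_
  by_cases hi : p.coeff i = 0
  · simp [hi]
  · rw [(hp i (mem_support_iff.2 hi)).neg_pow, smul_neg]

theorem isNilpotent_aeval_of_odd_support {p : R[X]} (hp : ∀ i ∈ p.support, Odd i) {a : S}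
    (ha : IsNilpotent a) : IsNilpotent (aeval a p) := by
  have h0 : p.coeff 0 = 0 := by
    by_contra h
    exact absurd (hp 0 (mem_support_iff.2 h)) (by decide)
  obtain ⟨q, rfl⟩ := X_dvd_iff.2 h0
  rw [map_mul, aeval_X]
  refine Commute.isNilpotent_mul_right ?_ ha
  simpa using Commute.map (Commute.all (X : R[X]) q) (aeval a)

/-- The twisted sum `∑ (-a)ⁱ e aᵏ⁻ⁱ`, which anticommutes with `a` when `a ^ (k + 1) = 0`. -/
def alternatingSum (a e : S) (k : ℕ) : S :=
  ∑ i ∈ Finset.range (k + 1), (-a) ^ i * e * a ^ (k - i)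

theorem mul_alternatingSum {a : S} {k : ℕ} (ha : a ^ (k + 1) = 0) (e : S) :
    a * alternatingSum a e k = -(alternatingSum a e k * a) := by
  have hl : a * alternatingSum a e k =
      -∑ i ∈ Finset.range (k + 1), (-a) ^ (i + 1) * e * a ^ (k + 1 - (i + 1)) := by
    simp [alternatingSum, Finset.mul_sum, pow_succ', mul_assoc]
  have hr : alternatingSum a e k * a =
      ∑ i ∈ Finset.range (k + 1), (-a) ^ i * e * a ^ (k + 1 - i) := by
    rw [alternatingSum, Finset.sum_mul]
    refine Finset.sum_congr rfl fun i hi => ?_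
    rw [mul_assoc, ← pow_succ, Nat.succ_sub (Finset.mem_range_succ_iff.1 hi)]
  have hs := (Finset.sum_range_succ' (fun i => (-a) ^ i * e * a ^ (k + 1 - i)) (k + 1)).symm.trans
    (Finset.sum_range_succ (fun i => (-a) ^ i * e * a ^ (k + 1 - i)) (k + 1))
  have hn : (-a) ^ (k + 1) = 0 := by rw [neg_pow, ha, mul_zero]
  simp only [hn, ha, Nat.sub_zero, zero_mul, mul_zero, add_zero] at hs
  rw [hl, hr, hs]

theorem alternatingSum_mul_of_mul_eq_zero {a d : S} (had : a * d = 0) (e : S) (k : ℕ) :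
    alternatingSum a e k * d = (-a) ^ k * e * d := by
  rw [alternatingSum, Finset.sum_mul, Finset.sum_range_succ, Finset.sum_eq_zero]
  · simp
  · intro i hi
    obtain ⟨j, hj⟩ := Nat.exists_eq_add_of_lt (Finset.mem_range.1 hi)
    rw [show k - i = j + 1 by omega, pow_succ, mul_assoc, mul_assoc (a ^ j), had, mul_zero,
      mul_zero]

end AntiCommuting

section Matrix

variable {n : ℕ} {F : Type*} [Field F]

theorem clifforder_subset_of_odd_support {p : F[X]} (hp : ∀ i ∈ p.support, Odd i)
    (A : Matrix (Fin n) (Fin n) F) : clifforder A ⊆ clifforder (aeval A p) := by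
  intro X hX
  change aeval A p * X = -(X * aeval A p)
  rw [aeval_mul_eq_mul_aeval_neg hX, aeval_neg_of_odd_support hp, mul_neg]

theorem mul_single_mul_apply (M N : Matrix (Fin n) (Fin n) F) (i j k l : Fin n) :
    (M * (Matrix.single j k 1 : Matrix (Fin n) (Fin n) F) * N) i l = M i j * N k l := by
  simp [Matrix.mul_apply, Matrix.single, ite_and, Finset.sum_ite_eq]

theorem eq_zero_of_alternatingSum_mul_eq_zero {A D : Matrix (Fin n) (Fin n) F} {k : ℕ}
    (hA : A ^ (k + 1) = 0) (hk : A ^ k ≠ 0) (hAD : Commute A D)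
    (h : ∀ E, alternatingSum A E k * D = 0) : D = 0 := by
  by_contra hD
  have hex : ∃ m, A ^ m * D = 0 := ⟨k + 1, by rw [hA, zero_mul]⟩
  classical
  obtain ⟨m, hm⟩ : ∃ m, Nat.find hex = m + 1 :=
    Nat.exists_eq_succ_of_ne_zero fun h0 => hD (by simpa [h0] using Nat.find_spec hex)
  have hD' : A ^ m * D ≠ 0 := Nat.find_min hex (by omega)
  have hAD' : A * (A ^ m * D) = 0 := by
    rw [← mul_assoc, ← pow_succ', ← hm]
    exact Nat.find_spec hex
  have hk' : (-A) ^ k ≠ 0 := by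
    rwa [neg_pow, Ne, ((isUnit_one.neg).pow k).mul_right_eq_zero]
  obtain ⟨a, b, hab⟩ : ∃ a b, ((-A) ^ k) a b ≠ 0 := by
    by_contra! h0
    exact hk' (Matrix.ext h0)
  obtain ⟨c, d, hcd⟩ : ∃ c d, (A ^ m * D) c d ≠ 0 := by
    by_contra! h0
    exact hD' (Matrix.ext h0)
  have h0 : (-A) ^ k * Matrix.single b c 1 * (A ^ m * D) = 0 := by
    rw [← alternatingSum_mul_of_mul_eq_zero hAD', (hAD.pow_left m).eq, ← mul_assoc, h, zero_mul]
  have := congrFun (congrFun h0 a) d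
  rw [mul_single_mul_apply] at this
  exact mul_ne_zero hab hcd this

theorem alternatingSum_single_mul_apply (A M : Matrix (Fin n) (Fin n) F) (k : ℕ)
    (a b c d : Fin n) :
    (alternatingSum A (Matrix.single c a 1) k * M) d b =
      (aeval A (∑ i ∈ Finset.range (k + 1), C ((A ^ (k - i) * M) a b) * (-X) ^ i)) d c := by
  simp only [alternatingSum, Finset.sum_mul, map_sum, Matrix.sum_apply]
  refine Finset.sum_congr rfl fun i _ => ?_
  rw [mul_assoc _ (A ^ (k - i)), mul_single_mul_apply, ← smul_eq_C_mul]
  simp [mul_comm]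

theorem exists_aeval_eq_of_clifforder_subset {A B : Matrix (Fin n) (Fin n) F} {k : ℕ}
    (hA : A ^ (k + 1) = 0) (hk : A ^ k ≠ 0) (h : clifforder A ⊆ clifforder B) :
    ∃ p : F[X], B = aeval A p := by
  obtain ⟨a, b, hab⟩ : ∃ a b, (A ^ k) a b ≠ 0 := by
    by_contra! h0
    exact hk (Matrix.ext h0)
  let P (M : Matrix (Fin n) (Fin n) F) : F[X] :=
    ∑ i ∈ Finset.range (k + 1), C ((A ^ (k - i) * M) a b) * (-X) ^ i
  have hP : B * aeval A (P 1) = aeval A (-P B) := by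
    ext d c
    have hX := h (mul_alternatingSum hA (Matrix.single c a 1))
    have hX' := congrFun (congrFun hX d) b
    rw [Matrix.neg_apply, alternatingSum_single_mul_apply] at hX'
    rw [map_neg, Matrix.neg_apply, ← hX', Matrix.mul_apply, Matrix.mul_apply]
    refine Finset.sum_congr rfl fun e _ => ?_
    rw [← alternatingSum_single_mul_apply, mul_one]
  have h0 : (P 1).coeff 0 ≠ 0 := by
    have : (P 1).coeff 0 = (A ^ k) a b := by
      simp [P, coeff_zero_eq_eval_zero, eval_finsetSum, zero_pow_eq]
    rwa [this]
  have hco : IsCoprime (P 1) (X ^ (k + 1)) :=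
    ((irreducible_X.coprime_iff_not_dvd.2 (mt X_dvd_iff.1 h0)).symm).pow_right
  obtain ⟨u, v, huv⟩ := hco
  refine ⟨-P B * u, ?_⟩
  have h1 := congrArg (aeval A) huv
  rw [mul_comm u] at h1
  simp only [map_add, map_mul, map_pow, aeval_X, hA, mul_zero, add_zero, map_one] at h1
  rw [map_mul, ← hP, mul_assoc, h1, mul_one]

theorem exists_odd_aeval_eq_of_clifforder_subset [CharZero F] {A B : Matrix (Fin n) (Fin n) F}
    (hA : IsNilpotent A) (h : clifforder A ⊆ clifforder B) :
    ∃ p : F[X], (∀ i ∈ p.support, Odd i) ∧ B = aeval A p := by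
  cases subsingleton_or_nontrivial (Matrix (Fin n) (Fin n) F)
  · exact ⟨0, by simp, Subsingleton.elim _ _⟩
  obtain ⟨k, hk⟩ := Nat.exists_eq_succ_of_ne_zero (pos_nilpotencyClass_iff.2 hA).ne'
  have hA0 : A ^ (k + 1) = 0 := by simpa [hk] using pow_nilpotencyClass hA
  have hk0 : A ^ k ≠ 0 := by simpa [hk] using pow_pred_nilpotencyClass hA
  obtain ⟨p, rfl⟩ := exists_aeval_eq_of_clifforder_subset hA0 hk0 h
  have hneg : aeval (-A) p = aeval A (p.comp (-X)) := by simp [aeval_comp]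
  have hsum : aeval A (p + p.comp (-X)) = 0 := by
    refine eq_zero_of_alternatingSum_mul_eq_zero hA0 hk0 ?_ fun E => ?_
    · simpa using Commute.map (Commute.all (X : F[X]) (p + p.comp (-X))) (aeval A)
    · have hX := mul_alternatingSum hA0 E
      have hpX : aeval A p * _ = -(_ * aeval A p) := h hX
      rw [map_add, mul_add, ← hneg, ← aeval_mul_eq_mul_aeval_neg hX, hpX, add_neg_cancel]
  refine ⟨C 2⁻¹ * (p - p.comp (-X)), fun i hi => ?_, ?_⟩
  · have hX : (-X : F[X]) = C (-1) * X := by simp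
    by_contra hodd
    rw [mem_support_iff, coeff_C_mul, coeff_sub, hX, comp_C_mul_X_coeff,
      (Nat.not_odd_iff_even.1 hodd).neg_one_pow] at hi
    simp at hi
  · have hc : aeval A (p.comp (-X)) = -aeval A p :=
      eq_neg_of_add_eq_zero_right (by rwa [map_add] at hsum)
    rw [← smul_eq_C_mul, map_smul, map_sub, hc, sub_neg_eq_add, ← two_smul F, smul_smul,
      inv_mul_cancel₀ two_ne_zero, one_smul]

theorem OddPolyEquiv.symm {A B : Matrix (Fin n) (Fin n) F} (h : OddPolyEquiv A B) :
    OddPolyEquiv B A := by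
  obtain ⟨f, g, hf, hg, hB, hA⟩ := h
  exact ⟨g, f, hg, hf, hA, hB⟩

theorem oddPolyEquiv_of_clifforder_eq [CharZero F] {A B : Matrix (Fin n) (Fin n) F}
    (hA : IsNilpotent A) (h : clifforder A = clifforder B) : OddPolyEquiv A B := by
  obtain ⟨f, hf, hB⟩ := exists_odd_aeval_eq_of_clifforder_subset hA h.subset
  obtain ⟨g, hg, hA'⟩ := exists_odd_aeval_eq_of_clifforder_subset
    (hB ▸ isNilpotent_aeval_of_odd_support hf hA) h.symm.subset
  exact ⟨f, g, hf, hg, hB, hA'⟩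

end Matrix

theorem clifforder_eq_iff_oddPolyEquiv_of_nilpotent {n : ℕ} {F : Type*} [Field F] [CharZero F]
    (A B : Matrix (Fin n) (Fin n) F) (hnil : IsNilpotent A ∨ IsNilpotent B) :
    clifforder A = clifforder B ↔ OddPolyEquiv A B := by
  constructor
  · intro h
    rcases hnil with hA | hB
    · exact oddPolyEquiv_of_clifforder_eq hA h
    · exact (oddPolyEquiv_of_clifforder_eq hB h.symm).symm
  · rintro ⟨f, g, hf, hg, hB, hA⟩
    apply Set.Subset.antisymm
    · rw [hB]
      exact clifforder_subset_of_odd_support hf A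
    · rw [hA]
      exact clifforder_subset_of_odd_support hg B
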